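/- Let L = (L_p) be a weight sequence satisfying snq and sm, and let A = (A_p) be a sequence of nonnegative reals such that for every h > 0 there exists C(h) > 0 with A_p ≤ C(h) h^p L_p for all p. Then there exists a weight sequence K = (K_p) satisfying snq and sm such that: (i) there is D > 0 with A_p ≤ D K_p for all p; (ii) for every h > 0 there exists C'(h) > 0 with K_p ≤ C'(h) h^p L_p for all p. -/

import Mathlib

/-- `M` is a weight sequence: `M 0 = 1`, positive, log-convex and with quotients
tending to infinity. -/
def IsWeightSeq (M : ℕ → ℝ) : Prop :=
  (∀ p, 0 < M p) ∧ M 0 = 1 ∧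
  (∀ p : ℕ, M (p+1) / M p ≤ M (p+2) / M (p+1)) ∧
  Filter.Tendsto (fun p : ℕ => M (p+1) / M p) Filter.atTop Filter.atTop

/-- `M` is strongly non-quasianalytic. -/
def IsSnq (M : ℕ → ℝ) : Prop :=
  ∃ C > (0:ℝ), ∀ p : ℕ,
    Summable (fun k : ℕ => 1 / (((p + k : ℕ) + 1 : ℝ) * (M (p + k + 1) / M (p + k)))) ∧
    (∑' k : ℕ, 1 / (((p + k : ℕ) + 1 : ℝ) * (M (p + k + 1) / M (p + k)))) ≤
      C / (M (p+1) / M p)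

/-- `M` has shifted moments. -/
def HasSm (M : ℕ → ℝ) : Prop :=
  ∃ C0 > (0:ℝ), ∃ H > (1:ℝ), ∀ p : ℕ,
    Real.log ((M (p+2) / M (p+1)) / (M (p+1) / M p)) ≤ C0 * H ^ (p+1)

open Filter Topology Finset

/-- A sequence tending to zero is dominated by a positive antitone sequence tending to zero. -/
lemma exists_antitone_majorant {u : ℕ → ℝ} (hu : Tendsto u atTop (𝓝 0)) :
    ∃ v : ℕ → ℝ, Antitone v ∧ (∀ n, 0 < v n) ∧ Tendsto v atTop (𝓝 0) ∧ ∀ n, u n ≤ v n := by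
  have hbdd : BddAbove (Set.range fun i => |u i|) := by
    simpa using hu.abs.bddAbove_range
  have hbdd' : ∀ n, BddAbove (Set.range fun k => |u (n + k)|) := fun n =>
    hbdd.mono (by rintro _ ⟨k, rfl⟩; exact ⟨n + k, rfl⟩)
  have hle : ∀ n k, |u (n + k)| ≤ ⨆ k, |u (n + k)| := fun n k => le_ciSup (hbdd' n) k
  have hnonneg : ∀ n, 0 ≤ ⨆ k, |u (n + k)| := fun n => (abs_nonneg _).trans (hle n 0)
  refine ⟨fun n => (⨆ k, |u (n + k)|) + 1 / ((n : ℝ) + 1), ?_, ?_, ?_, ?_⟩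
  · refine antitone_nat_of_succ_le fun n => add_le_add (ciSup_le fun k => ?_) ?_
    · have := hle n (k + 1)
      rwa [show n + (k + 1) = n + 1 + k by ring] at this
    · exact Nat.one_div_le_one_div n.le_succ
  · intro n
    have := hnonneg n
    positivity
  · have hsup : Tendsto (fun n => ⨆ k, |u (n + k)|) atTop (𝓝 0) := by
      rw [Metric.tendsto_atTop] at hu ⊢
      intro ε hε
      obtain ⟨N, hN⟩ := hu (ε / 2) (half_pos hε)
      refine ⟨N, fun n hn => ?_⟩
      rw [Real.dist_0_eq_abs, abs_of_nonneg (hnonneg n)]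
      refine (ciSup_le fun k => ?_).trans_lt (half_lt_self hε)
      simpa using (hN (n + k) (by omega)).le
    simpa using hsup.add tendsto_one_div_add_atTop_nhds_zero_nat
  · intro n
    have h1 := hle n 0
    have h2 := le_abs_self (u n)
    have h3 : (0 : ℝ) < 1 / ((n : ℝ) + 1) := by positivity
    simp only [add_zero] at h1
    linarith

/-- A nonnegative sequence decaying faster than every geometric one is dominated, up to a
constant, by the products of a positive antitone null sequence. -/
lemma exists_antitone_prod_majorant {b : ℕ → ℝ} (hb : ∀ p, 0 ≤ b p)
    (hdom : ∀ h : ℝ, 0 < h → ∃ C > (0 : ℝ), ∀ p : ℕ, b p ≤ C * h ^ p) :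
    ∃ δ : ℕ → ℝ, Antitone δ ∧ (∀ n, 0 < δ n) ∧ Tendsto δ atTop (𝓝 0) ∧
      ∃ D > (0 : ℝ), ∀ p, b p ≤ D * ∏ j ∈ range p, δ j := by
  set r : ℕ → ℝ := fun p => b p ^ ((p : ℝ)⁻¹) with hr
  have hr0 : ∀ p, 0 ≤ r p := fun p => Real.rpow_nonneg (hb p) _
  have hrpow : ∀ p, p ≠ 0 → r p ^ p = b p := fun p hp => Real.rpow_inv_natCast_pow (hb p) hp
  have hrlim : Tendsto r atTop (𝓝 0) := by
    rw [Metric.tendsto_atTop]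
    intro ε hε
    obtain ⟨C, hC, hCb⟩ := hdom (ε / 4) (by positivity)
    obtain ⟨N, hN⟩ := pow_unbounded_of_one_lt C (one_lt_two : (1 : ℝ) < 2)
    refine ⟨N + 1, fun n hn => ?_⟩
    rw [Real.dist_0_eq_abs, abs_of_nonneg (hr0 n)]
    have hpow : r n ^ n ≤ (ε / 2) ^ n := by
      rw [hrpow n (by omega)]
      calc b n ≤ C * (ε / 4) ^ n := hCb n
        _ ≤ 2 ^ n * (ε / 4) ^ n := by
          gcongr
          exact hN.le.trans (pow_le_pow_right₀ one_le_two (by omega))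
        _ = (ε / 2) ^ n := by rw [← mul_pow]; ring
    have := le_of_pow_le_pow_left₀ (by omega) (by positivity) hpow
    linarith
  obtain ⟨v, hv, hv0, hvlim, hrv⟩ := exists_antitone_majorant (hrlim.comp (tendsto_add_atTop_nat 1))
  refine ⟨v, hv, hv0, hvlim, b 0 + 1, by linarith [hb 0], fun p => ?_⟩
  rcases p with _ | p
  · simp
  · have hprod : b (p + 1) ≤ ∏ j ∈ range (p + 1), v j := by
      rw [← hrpow (p + 1) (by omega)]
      calc r (p + 1) ^ (p + 1) = ∏ _j ∈ range (p + 1), r (p + 1) := by simp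
        _ ≤ ∏ j ∈ range (p + 1), v j := by
          refine prod_le_prod (fun _ _ => hr0 _) fun j hj => (hrv p).trans (hv ?_)
          have := mem_range.1 hj
          omega
    exact hprod.trans (le_mul_of_one_le_left (prod_nonneg fun j _ => (hv0 j).le)
      (by linarith [hb 0]))

/-- The products of a positive null sequence decay faster than every geometric sequence. -/
lemma exists_prod_le_mul_pow {e : ℕ → ℝ} (he : ∀ n, 0 < e n) (hlim : Tendsto e atTop (𝓝 0))
    {h : ℝ} (hh : 0 < h) : ∃ C > (0 : ℝ), ∀ p, ∏ j ∈ range p, e j ≤ C * h ^ p := by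
  obtain ⟨N, hN⟩ := eventually_atTop.1 (hlim.eventually_le_const hh)
  have hquot : ∀ p, (∏ j ∈ range p, e j / h) ≤ ∏ j ∈ range N, max 1 (e j / h) := by
    intro p
    have h1 : ∀ j, 1 ≤ max 1 (e j / h) := fun j => le_max_left _ _
    have h2 : (∏ j ∈ range p, e j / h) ≤ ∏ j ∈ range p, max 1 (e j / h) :=
      prod_le_prod (fun j _ => (div_pos (he j) hh).le) fun j _ => le_max_right _ _
    rcases le_total p N with hp | hp
    · refine h2.trans ?_
      rw [← prod_range_mul_prod_Ico _ hp]
      exact le_mul_of_one_le_right (prod_nonneg fun j _ => zero_le_one.trans (h1 j))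
        (one_le_prod fun j _ => h1 j)
    · refine h2.trans (le_of_eq ?_)
      refine (prod_subset (range_mono hp) fun j _ hj => max_eq_left ?_).symm
      exact (div_le_one hh).2 (hN j (by simpa using hj))
  refine ⟨∏ j ∈ range N, max 1 (e j / h),
    prod_pos fun j _ => zero_lt_one.trans_le (le_max_left _ _), fun p => ?_⟩
  have := hquot p
  rwa [prod_div_distrib, prod_const, card_range, div_le_iff₀ (by positivity)] at this

/-- The strong non-quasianalyticity estimate passes to square roots of the quotients. -/
lemma sum_one_div_mul_sqrt_le {l : ℕ → ℝ} (hl : ∀ q, 0 < l q) {C : ℝ} (hC : 0 < C)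
    (h : ∀ p : ℕ, Summable (fun k : ℕ => 1 / (((p + k : ℕ) + 1 : ℝ) * l (p + k))) ∧
      (∑' k : ℕ, 1 / (((p + k : ℕ) + 1 : ℝ) * l (p + k))) ≤ C / l p) (p n : ℕ) :
    ∑ k ∈ range n, 1 / (((p + k : ℕ) + 1 : ℝ) * √(l (p + k))) ≤ 2 * C / √(l p) := by
  set S : ℕ → ℝ := fun p => ∑' k : ℕ, 1 / (((p + k : ℕ) + 1 : ℝ) * l (p + k)) with hS
  have hS0 : ∀ q, 0 ≤ S q := fun q => tsum_nonneg fun k => by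
    have := hl (q + k)
    positivity
  have hrec : ∀ q : ℕ, S q = 1 / (((q : ℝ) + 1) * l q) + S (q + 1) := by
    intro q
    simp only [hS]
    rw [(h q).1.tsum_eq_zero_add]
    simp [add_comm, add_left_comm]
  have hroot : ∀ q, √(S q) ≤ √C / √(l q) := fun q => by
    rw [← Real.sqrt_div hC.le]
    exact Real.sqrt_le_sqrt (h q).2
  have hstep : ∀ q : ℕ, 1 / (((q : ℝ) + 1) * √(l q)) ≤ 2 * √C * (√(S q) - √(S (q + 1))) := by
    intro q
    have hq : 0 < √(l q) := Real.sqrt_pos.2 (hl q)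
    have hpos : (0 : ℝ) < 1 / (((q : ℝ) + 1) * l q) := by
      have := hl q
      positivity
    have hmono : √(S (q + 1)) ≤ √(S q) := Real.sqrt_le_sqrt (by linarith [hrec q])
    have hdiff : (√(S q) - √(S (q + 1))) * (√(S q) + √(S (q + 1))) =
        1 / (((q : ℝ) + 1) * l q) := by
      have h1 := Real.mul_self_sqrt (hS0 q)
      have h2 := Real.mul_self_sqrt (hS0 (q + 1))
      linear_combination h1 - h2 + hrec q
    calc 1 / (((q : ℝ) + 1) * √(l q)) = 1 / (((q : ℝ) + 1) * l q) * √(l q) := by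
          nth_rewrite 2 [← Real.mul_self_sqrt (hl q).le]
          field_simp
      _ = (√(S q) - √(S (q + 1))) * (√(S q) + √(S (q + 1))) * √(l q) := by rw [hdiff]
      _ ≤ (√(S q) - √(S (q + 1))) * (2 * (√C / √(l q))) * √(l q) := by
          have := hroot q
          gcongr
          · linarith
      _ = 2 * √C * (√(S q) - √(S (q + 1))) := by field_simp
  calc ∑ k ∈ range n, 1 / (((p + k : ℕ) + 1 : ℝ) * √(l (p + k)))
      ≤ ∑ k ∈ range n, 2 * √C * (√(S (p + k)) - √(S (p + (k + 1)))) :=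
        sum_le_sum fun k _ => hstep (p + k)
    _ = 2 * √C * (√(S p) - √(S (p + n))) := by
        rw [← mul_sum, sum_range_sub' fun k => √(S (p + k)), add_zero]
    _ ≤ 2 * √C * (√C / √(l p)) := by
        gcongr
        linarith [hroot p, Real.sqrt_nonneg (S (p + n))]
    _ = 2 * C / √(l p) := by
        rw [mul_div_assoc', mul_assoc, Real.mul_self_sqrt hC.le]

/-- Adaptation of Chaumat–Chollet Proposition 17 with `mg` replaced by `sm`. -/
theorem exists_interpolating_weight_seq (L : ℕ → ℝ)
    (hL : IsWeightSeq L) (hLsnq : IsSnq L) (hLsm : HasSm L)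
    (A : ℕ → ℝ) (hA : ∀ p, 0 ≤ A p)
    (hdom : ∀ h : ℝ, 0 < h → ∃ C > (0:ℝ), ∀ p : ℕ, A p ≤ C * h ^ p * L p) :
    ∃ K : ℕ → ℝ, IsWeightSeq K ∧ IsSnq K ∧ HasSm K ∧
      (∃ D > (0:ℝ), ∀ p : ℕ, A p ≤ D * K p) ∧
      (∀ h : ℝ, 0 < h → ∃ C' > (0:ℝ), ∀ p : ℕ, K p ≤ C' * h ^ p * L p) := by
  obtain ⟨hLpos, hL0, hLconv, hLlim⟩ := hL
  obtain ⟨C, hC, hCsum⟩ := hLsnq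
  obtain ⟨C0, hC0, H, hH, hsm⟩ := hLsm
  obtain ⟨δ, hδanti, hδpos, hδlim, D, hD, hbD⟩ :=
    exists_antitone_prod_majorant (b := fun p => A p / L p)
      (fun p => div_nonneg (hA p) (hLpos p).le) fun h hh => by
        obtain ⟨c, hc, hcA⟩ := hdom h hh
        exact ⟨c, hc, fun p => (div_le_iff₀ (hLpos p)).2 (hcA p)⟩
  set l : ℕ → ℝ := fun p => L (p + 1) / L p with hl
  have hlpos : ∀ p, 0 < l p := fun p => div_pos (hLpos _) (hLpos _)
  have hlmono : Monotone l := monotone_nat_of_le_succ hLconv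
  have hspos : ∀ p, 0 < √(l p) := fun p => Real.sqrt_pos.2 (hlpos p)
  have hsmono : Monotone fun p => √(l p) := fun _ _ hpq => Real.sqrt_le_sqrt (hlmono hpq)
  have hslim : Tendsto (fun p => √(l p)) atTop atTop := Real.tendsto_sqrt_atTop.comp hLlim
  have hLprod : ∀ p, ∏ j ∈ range p, l j = L p := fun p => by
    induction p with
    | zero => simp [hL0]
    | succ p ih => rw [prod_range_succ, ih, hl, mul_div_cancel₀ _ (hLpos p).ne']
  set g : ℕ → ℝ := fun p => partialSups (fun i => √(l i) * δ i) p with hg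
  -- The running maximum `g` makes `g / √l` antitone and `√l * g` monotone.
  have hgmono : Monotone g := (partialSups fun i => √(l i) * δ i).monotone'
  have hδg : ∀ i, √(l i) * δ i ≤ g i := fun i => le_partialSups (fun i => √(l i) * δ i) i
  have hgpos : ∀ i, 0 < g i := fun i => (mul_pos (hspos i) (hδpos i)).trans_le (hδg i)
  have hgsucc : ∀ p, g (p + 1) * √(l p) ≤ g p * √(l (p + 1)) := by
    intro p
    have hmax : g (p + 1) = max (g p) (√(l (p + 1)) * δ (p + 1)) :=
      partialSups_add_one (fun i => √(l i) * δ i) p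
    have h1 := hsmono p.le_succ
    have h2 := hδanti p.le_succ
    rw [hmax, max_mul_of_nonneg _ _ (hspos p).le]
    refine max_le (mul_le_mul_of_nonneg_left h1 (hgpos p).le) ?_
    calc √(l (p + 1)) * δ (p + 1) * √(l p) = √(l p) * δ (p + 1) * √(l (p + 1)) := by ring
      _ ≤ √(l p) * δ p * √(l (p + 1)) := by gcongr
      _ ≤ g p * √(l (p + 1)) := by
        gcongr
        exact hδg p
  have helim : Tendsto (fun p => g p / √(l p)) atTop (𝓝 0) := by
    rw [Metric.tendsto_atTop]
    intro ε hε
    obtain ⟨N, hN⟩ := eventually_atTop.1 (hδlim.eventually_le_const (half_pos hε))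
    obtain ⟨P, hP⟩ := eventually_atTop.1 (hslim.eventually_gt_atTop (g N / (ε / 2)))
    refine ⟨P, fun p hp => ?_⟩
    rw [Real.dist_0_eq_abs, abs_of_pos (div_pos (hgpos p) (hspos p)), div_lt_iff₀ (hspos p)]
    have hbig : g N < √(l p) * (ε / 2) := (div_lt_iff₀ (half_pos hε)).1 (hP p hp)
    have hle : g p ≤ max (g N) (√(l p) * (ε / 2)) := by
      refine partialSups_le (fun i => √(l i) * δ i) p _ fun i hi => ?_
      rcases le_total i N with hiN | hiN
      · exact ((hδg i).trans (hgmono hiN)).trans (le_max_left _ _)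
      · refine le_trans ?_ (le_max_right _ _)
        exact mul_le_mul (hsmono hi) (hN i hiN) (hδpos i).le (hspos p).le
    rw [max_eq_right hbig.le] at hle
    nlinarith [mul_pos (hspos p) hε]
  set k : ℕ → ℝ := fun p => √(l p) * g p with hk
  have hkpos : ∀ p, 0 < k p := fun p => mul_pos (hspos p) (hgpos p)
  have hkmono : Monotone k := fun p q hpq =>
    mul_le_mul (hsmono hpq) (hgmono hpq) (hgpos p).le (hspos q).le
  have hkl : ∀ p, k p = l p * (g p / √(l p)) := fun p => by
    have h1 := hspos p
    have h2 := Real.mul_self_sqrt (hlpos p).le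
    rw [mul_div_assoc', eq_div_iff h1.ne']
    linear_combination g p * h2
  set K : ℕ → ℝ := fun p => ∏ j ∈ range p, k j with hK
  have hKpos : ∀ p, 0 < K p := fun p => prod_pos fun j _ => hkpos j
  have hKquot : ∀ p, K (p + 1) / K p = k p := fun p => by
    rw [div_eq_iff (hKpos p).ne', mul_comm]
    exact prod_range_succ k p
  have hKL : ∀ p, K p = L p * ∏ j ∈ range p, g j / √(l j) := fun p => by
    rw [← hLprod p, ← prod_mul_distrib]
    exact prod_congr rfl fun j _ => hkl j
  refine ⟨K, ⟨hKpos, prod_range_zero k, fun p => ?_, ?_⟩,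
    ⟨2 * C, by positivity, fun p => ?_⟩, ⟨C0, hC0, H, hH, fun p => ?_⟩,
    ⟨D, hD, fun p => ?_⟩, fun h hh => ?_⟩
  · rw [hKquot p, hKquot (p + 1)]
    exact hkmono p.le_succ
  · simp only [hKquot]
    exact tendsto_atTop_mono
      (fun p => mul_le_mul_of_nonneg_left (hgmono p.zero_le) (hspos p).le)
      (hslim.atTop_mul_const (hgpos 0))
  · simp only [hKquot]
    have hbound : ∀ n, ∑ i ∈ range n, 1 / (((p + i : ℕ) + 1 : ℝ) * k (p + i)) ≤ 2 * C / k p := by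
      intro n
      calc ∑ i ∈ range n, 1 / (((p + i : ℕ) + 1 : ℝ) * k (p + i))
          ≤ ∑ i ∈ range n, 1 / (((p + i : ℕ) + 1 : ℝ) * √(l (p + i))) / g p := by
            refine sum_le_sum fun i _ => ?_
            have h1 := hspos (p + i)
            have h2 := hgpos p
            rw [div_div, mul_assoc]
            gcongr
            exact mul_le_mul_of_nonneg_left (hgmono (Nat.le_add_right p i)) h1.le
        _ ≤ 2 * C / √(l p) / g p := by
            rw [← sum_div]
            exact div_le_div_of_nonneg_right (sum_one_div_mul_sqrt_le hlpos hC hCsum p n)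
              (hgpos p).le
        _ = 2 * C / k p := by rw [div_div]
    have hnonneg : ∀ i, 0 ≤ 1 / (((p + i : ℕ) + 1 : ℝ) * k (p + i)) := fun i => by
      have := hkpos (p + i)
      positivity
    exact ⟨summable_of_sum_range_le hnonneg hbound, Real.tsum_le_of_sum_range_le hnonneg hbound⟩
  · rw [hKquot p, hKquot (p + 1)]
    refine le_trans (Real.log_le_log (div_pos (hkpos _) (hkpos _)) ?_) (hsm p)
    change k (p + 1) / k p ≤ l (p + 1) / l p
    rw [div_le_div_iff₀ (hkpos p) (hlpos p)]
    have h1 := Real.mul_self_sqrt (hlpos p).le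
    have h2 := Real.mul_self_sqrt (hlpos (p + 1)).le
    calc k (p + 1) * l p = √(l p) * √(l (p + 1)) * (g (p + 1) * √(l p)) := by
          linear_combination (-k (p + 1)) * h1
      _ ≤ √(l p) * √(l (p + 1)) * (g p * √(l (p + 1))) :=
          mul_le_mul_of_nonneg_left (hgsucc p) (mul_pos (hspos _) (hspos _)).le
      _ = l (p + 1) * k p := by linear_combination k p * h2
  · have hprod : ∏ j ∈ range p, δ j ≤ ∏ j ∈ range p, g j / √(l j) := by
      refine prod_le_prod (fun j _ => (hδpos j).le) fun j _ => ?_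
      rw [le_div_iff₀ (hspos j), mul_comm]
      exact hδg j
    have := (div_le_iff₀ (hLpos p)).1 (hbD p)
    calc A p ≤ D * (∏ j ∈ range p, δ j) * L p := this
      _ ≤ D * (∏ j ∈ range p, g j / √(l j)) * L p :=
          mul_le_mul_of_nonneg_right (mul_le_mul_of_nonneg_left hprod hD.le) (hLpos p).le
      _ = D * K p := by rw [hKL p]; ring
  · obtain ⟨c, hc, hce⟩ :=
      exists_prod_le_mul_pow (fun p => div_pos (hgpos p) (hspos p)) helim hh
    refine ⟨c, hc, fun p => ?_⟩
    rw [hKL p, mul_comm]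
    exact mul_le_mul_of_nonneg_right (hce p) (hLpos p).le
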